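/- Let A0, A1, B0S, B1S, B0L, B1L be self-adjoint operators squaring to the identity, with [A_x, B_{yz}] = 0 for all x, y, z and [B_{0L}, B_{1L}] = 0. Define C_S = A0B0S + A0B1S + A1B0S − A1B1S and J_L = A0B1L + A1B0L. Then for every u ∈ [0, π/4], the operator I_u = 2·1 − sin(u)·C_S − (cos(u) − sin(u))·J_L is positive semidefinite. Equivalently, for any quantum state, sin(u)·⟨C_S⟩ + (cos(u) − sin(u))·⟨J_L⟩ ≤ 2. -/

import Mathlib

open Real
open scoped InnerProductSpace

section Ring

variable {R : Type*} [Ring R] {a₀ a₁ b₀ b₁ : R}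

lemma chsh_mul_self (ha₀ : a₀ * a₀ = 1) (ha₁ : a₁ * a₁ = 1) (hb₀ : b₀ * b₀ = 1)
    (hb₁ : b₁ * b₁ = 1) (h₀₀ : Commute a₀ b₀) (h₀₁ : Commute a₀ b₁) (h₁₀ : Commute a₁ b₀)
    (h₁₁ : Commute a₁ b₁) :
    (a₀ * b₀ + a₀ * b₁ + a₁ * b₀ - a₁ * b₁) * (a₀ * b₀ + a₀ * b₁ + a₁ * b₀ - a₁ * b₁) =
      4 - (a₀ * a₁ - a₁ * a₀) * (b₀ * b₁ - b₁ * b₀) := by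
  have key : ∀ {a a' b b' : R}, Commute a' b → a * b * (a' * b') = a * a' * (b * b') :=
    fun h ↦ h.symm.mul_mul_mul_comm _ _
  simp only [add_mul, sub_mul, mul_add, mul_sub, key h₀₀, key h₀₁, key h₁₀, key h₁₁,
    ha₀, ha₁, hb₀, hb₁, one_mul, mul_one]
  rw [show (4 : R) = 1 + 1 + 1 + 1 by norm_num]
  abel

lemma crossed_mul_self (ha₀ : a₀ * a₀ = 1) (ha₁ : a₁ * a₁ = 1) (hb₀ : b₀ * b₀ = 1)
    (hb₁ : b₁ * b₁ = 1) (h₀₀ : Commute a₀ b₀) (h₀₁ : Commute a₀ b₁) (h₁₀ : Commute a₁ b₀)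
    (h₁₁ : Commute a₁ b₁) (hb : Commute b₀ b₁) :
    (a₀ * b₁ + a₁ * b₀) * (a₀ * b₁ + a₁ * b₀) =
      2 + (a₀ * a₁ + a₁ * a₀) * (b₀ * b₁) := by
  have key : ∀ {a a' b b' : R}, Commute a' b → a * b * (a' * b') = a * a' * (b * b') :=
    fun h ↦ h.symm.mul_mul_mul_comm _ _
  simp only [add_mul, mul_add, key h₀₀, key h₀₁, key h₁₀, key h₁₁,
    ha₀, ha₁, hb₀, hb₁, mul_one, ← hb.eq]
  rw [show (2 : R) = 1 + 1 by norm_num]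
  abel

end Ring

section Hilbert

variable {H : Type*} [NormedAddCommGroup H] [InnerProductSpace ℂ H]

lemma re_inner_ofNat_apply (k : ℕ) [k.AtLeastTwo] (x : H) :
    (⟪x, (OfNat.ofNat k : H →L[ℂ] H) x⟫_ℂ).re = OfNat.ofNat k * ‖x‖ ^ 2 := by
  have h : (OfNat.ofNat k : H →L[ℂ] H) x = ((k : ℝ) : ℂ) • x := by
    rw [← Nat.cast_ofNat (R := H →L[ℂ] H), Complex.ofReal_natCast, Nat.cast_smul_eq_nsmul]
    exact ContinuousLinearMap.natCast_apply k x
  rw [h, inner_smul_right, Complex.re_ofReal_mul]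
  exact congrArg _ (norm_sq_eq_re_inner (𝕜 := ℂ) x).symm

variable [CompleteSpace H]

lemma IsSelfAdjoint.inner_apply_left {T : H →L[ℂ] H} (hT : IsSelfAdjoint T) (x y : H) :
    ⟪T x, y⟫_ℂ = ⟪x, T y⟫_ℂ :=
  hT.isSymmetric x y

lemma IsSelfAdjoint.norm_apply_sq {T : H →L[ℂ] H} (hT : IsSelfAdjoint T) (x : H) :
    ‖T x‖ ^ 2 = (⟪x, (T * T) x⟫_ℂ).re := by
  rw [mul_apply_eq_comp, ← hT.inner_apply_left]
  exact norm_sq_eq_re_inner (𝕜 := ℂ) _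

lemma IsSelfAdjoint.norm_apply_of_mul_self {T : H →L[ℂ] H} (hT : IsSelfAdjoint T)
    (hsq : T * T = 1) (x : H) : ‖T x‖ = ‖x‖ := by
  rw [← sq_eq_sq₀ (norm_nonneg _) (norm_nonneg _), hT.norm_apply_sq, hsq]
  exact (norm_sq_eq_re_inner (𝕜 := ℂ) x).symm

variable {A₀ A₁ B₀ B₁ : H →L[ℂ] H}

lemma norm_chsh_apply_sq_le (hA₀ : IsSelfAdjoint A₀) (hA₁ : IsSelfAdjoint A₁)
    (hB₀ : IsSelfAdjoint B₀) (hB₁ : IsSelfAdjoint B₁)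
    (hA₀sq : A₀ * A₀ = 1) (hA₁sq : A₁ * A₁ = 1) (hB₀sq : B₀ * B₀ = 1) (hB₁sq : B₁ * B₁ = 1)
    (h₀₀ : Commute A₀ B₀) (h₀₁ : Commute A₀ B₁) (h₁₀ : Commute A₁ B₀) (h₁₁ : Commute A₁ B₁)
    (x : H) :
    ‖(A₀ * B₀ + A₀ * B₁ + A₁ * B₀ - A₁ * B₁) x‖ ^ 2 ≤
      4 * ‖x‖ ^ 2 + 2 * ‖(A₀ * A₁ - A₁ * A₀) x‖ * ‖x‖ := by
  have hC : IsSelfAdjoint (A₀ * B₀ + A₀ * B₁ + A₁ * B₀ - A₁ * B₁) :=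
    ((((hA₀.commute_iff hB₀).1 h₀₀).add ((hA₀.commute_iff hB₁).1 h₀₁)).add
      ((hA₁.commute_iff hB₀).1 h₁₀)).sub ((hA₁.commute_iff hB₁).1 h₁₁)
  have hQ : ‖(B₀ * B₁ - B₁ * B₀) x‖ ≤ 2 * ‖x‖ := by
    refine (norm_sub_le (B₀ (B₁ x)) (B₁ (B₀ x))).trans_eq ?_
    simp only [hB₀.norm_apply_of_mul_self hB₀sq, hB₁.norm_apply_of_mul_self hB₁sq]
    ring
  have hP : ⟪x, ((A₀ * A₁ - A₁ * A₀) * (B₀ * B₁ - B₁ * B₀)) x⟫_ℂ =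
      -⟪(A₀ * A₁ - A₁ * A₀) x, (B₀ * B₁ - B₁ * B₀) x⟫_ℂ := by
    rw [mul_apply_eq_comp]
    generalize (B₀ * B₁ - B₁ * B₀) x = y
    simp only [sub_apply, mul_apply_eq_comp, inner_sub_left,
      inner_sub_right, hA₀.inner_apply_left, hA₁.inner_apply_left]
    ring
  rw [hC.norm_apply_sq,
    chsh_mul_self hA₀sq hA₁sq hB₀sq hB₁sq h₀₀ h₀₁ h₁₀ h₁₁, sub_apply,
    inner_sub_right, hP, sub_neg_eq_add, Complex.add_re, re_inner_ofNat_apply]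
  have hcs := re_inner_le_norm (𝕜 := ℂ) ((A₀ * A₁ - A₁ * A₀) x) ((B₀ * B₁ - B₁ * B₀) x)
  have := mul_le_mul_of_nonneg_left hQ (norm_nonneg ((A₀ * A₁ - A₁ * A₀) x))
  simp only [RCLike.re_to_complex] at hcs
  linarith

lemma norm_crossed_apply_sq_le (hA₀ : IsSelfAdjoint A₀) (hA₁ : IsSelfAdjoint A₁)
    (hB₀ : IsSelfAdjoint B₀) (hB₁ : IsSelfAdjoint B₁)
    (hA₀sq : A₀ * A₀ = 1) (hA₁sq : A₁ * A₁ = 1) (hB₀sq : B₀ * B₀ = 1) (hB₁sq : B₁ * B₁ = 1)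
    (h₀₀ : Commute A₀ B₀) (h₀₁ : Commute A₀ B₁) (h₁₀ : Commute A₁ B₀) (h₁₁ : Commute A₁ B₁)
    (hB : Commute B₀ B₁) (x : H) :
    ‖(A₀ * B₁ + A₁ * B₀) x‖ ^ 2 ≤ 2 * ‖x‖ ^ 2 + ‖(A₀ * A₁ + A₁ * A₀) x‖ * ‖x‖ := by
  have hJ : IsSelfAdjoint (A₀ * B₁ + A₁ * B₀) :=
    ((hA₀.commute_iff hB₁).1 h₀₁).add ((hA₁.commute_iff hB₀).1 h₁₀)
  have hM : ‖(B₀ * B₁) x‖ = ‖x‖ := by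
    rw [mul_apply_eq_comp, hB₀.norm_apply_of_mul_self hB₀sq,
      hB₁.norm_apply_of_mul_self hB₁sq]
  have hW : ⟪x, ((A₀ * A₁ + A₁ * A₀) * (B₀ * B₁)) x⟫_ℂ =
      ⟪(A₀ * A₁ + A₁ * A₀) x, (B₀ * B₁) x⟫_ℂ := by
    rw [mul_apply_eq_comp]
    generalize (B₀ * B₁) x = y
    simp only [add_apply, mul_apply_eq_comp, inner_add_left,
      inner_add_right, hA₀.inner_apply_left, hA₁.inner_apply_left]
    ring
  rw [hJ.norm_apply_sq, crossed_mul_self hA₀sq hA₁sq hB₀sq hB₁sq h₀₀ h₀₁ h₁₀ h₁₁ hB,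
    add_apply, inner_add_right, hW, Complex.add_re, re_inner_ofNat_apply]
  have hcs := re_inner_le_norm (𝕜 := ℂ) ((A₀ * A₁ + A₁ * A₀) x) ((B₀ * B₁) x)
  rw [hM] at hcs
  simp only [RCLike.re_to_complex] at hcs
  linarith

lemma norm_commutator_sq_add_norm_anticommutator_sq
    (hA₀ : IsSelfAdjoint A₀) (hA₁ : IsSelfAdjoint A₁)
    (hA₀sq : A₀ * A₀ = 1) (hA₁sq : A₁ * A₁ = 1) (x : H) :
    ‖(A₀ * A₁ - A₁ * A₀) x‖ ^ 2 + ‖(A₀ * A₁ + A₁ * A₀) x‖ ^ 2 = 4 * ‖x‖ ^ 2 := by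
  have h := parallelogram_law_with_norm ℂ (A₀ (A₁ x)) (A₁ (A₀ x))
  simp only [hA₀.norm_apply_of_mul_self hA₀sq, hA₁.norm_apply_of_mul_self hA₁sq] at h
  simp only [sub_apply, add_apply,
    mul_apply_eq_comp]
  linarith

end Hilbert

lemma weighted_sum_le_two_mul {s c C J p w n : ℝ} (hs : 0 ≤ s) (hsc : s ≤ c)
    (hu : s ^ 2 + c ^ 2 = 1) (hn : 0 ≤ n)
    (hC : C ^ 2 ≤ 4 * n ^ 2 + 2 * p * n) (hJ : J ^ 2 ≤ 2 * n ^ 2 + w * n)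
    (hpw : p ^ 2 + w ^ 2 = 4 * n ^ 2) :
    s * C + (c - s) * J ≤ 2 * n := by
  have hc : 0 < c := by nlinarith
  have hd : 0 ≤ c - s := sub_nonneg.2 hsc
  have hk : 0 < c * (c + s) := by positivity
  refine le_of_sq_le_sq (le_of_mul_le_mul_left ?_ hk) (by positivity)
  have hcauchy : c * (c + s) * (s * C + (c - s) * J) ^ 2 ≤
      c * s * C ^ 2 + (c - s) * (c + s) * J ^ 2 := by
    have h : 0 ≤ s * (c - s) * (c * C - (c + s) * J) ^ 2 := by positivity
    linear_combination h + (c * s * C ^ 2 + (c - s) * (c + s) * J ^ 2) * hu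
  have h1 := mul_le_mul_of_nonneg_left hC (mul_nonneg hc.le hs)
  have h2 := mul_le_mul_of_nonneg_left hJ (mul_nonneg hd (by positivity : 0 ≤ c + s))
  have h3 := sq_nonneg (p / 2 - 2 * c * s * n)
  have h4 := sq_nonneg (w / 2 - (c - s) * (c + s) * n)
  linear_combination hcauchy + h1 + h2 + h3 + h4 + hpw / 4 +
    (n ^ 2 * (s ^ 2 + c ^ 2 - 1)) * hu

/-- SRQ tradeoff: with jointly measurable (commuting) long-path observables, the
operator `I_u = 2·1 − sin u·C_S − (cos u − sin u)·J_L` is positive semidefinite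
for every `u ∈ [0, π/4]`. -/
theorem stmt6 {H : Type*} [NormedAddCommGroup H] [InnerProductSpace ℂ H] [CompleteSpace H]
    (A0 A1 B0S B1S B0L B1L : H →L[ℂ] H)
    (hA0 : IsSelfAdjoint A0) (hA1 : IsSelfAdjoint A1)
    (hB0S : IsSelfAdjoint B0S) (hB1S : IsSelfAdjoint B1S)
    (hB0L : IsSelfAdjoint B0L) (hB1L : IsSelfAdjoint B1L)
    (hA0sq : A0 * A0 = 1) (hA1sq : A1 * A1 = 1)
    (hB0Ssq : B0S * B0S = 1) (hB1Ssq : B1S * B1S = 1)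
    (hB0Lsq : B0L * B0L = 1) (hB1Lsq : B1L * B1L = 1)
    (hc00S : Commute A0 B0S) (hc01S : Commute A0 B1S)
    (hc10S : Commute A1 B0S) (hc11S : Commute A1 B1S)
    (hc00L : Commute A0 B0L) (hc01L : Commute A0 B1L)
    (hc10L : Commute A1 B0L) (hc11L : Commute A1 B1L)
    (hBL : Commute B0L B1L)
    (u : ℝ) (hu : u ∈ Set.Icc 0 (π / 4)) :
    ∀ ψ : H,
      0 ≤ (⟪ψ, ((2 : H →L[ℂ] H) -
            (Real.sin u : ℂ) • (A0 * B0S + A0 * B1S + A1 * B0S - A1 * B1S) -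
            ((Real.cos u - Real.sin u : ℝ) : ℂ) • (A0 * B1L + A1 * B0L)) ψ⟫_ℂ).re := by
  intro ψ
  set C := A0 * B0S + A0 * B1S + A1 * B0S - A1 * B1S
  set J := A0 * B1L + A1 * B0L
  have hsin : 0 ≤ sin u := sin_nonneg_of_nonneg_of_le_pi hu.1 (by linarith [hu.2, pi_pos])
  have hle : sin u ≤ cos u := by
    rw [← cos_pi_div_two_sub]
    exact cos_le_cos_of_nonneg_of_le_pi hu.1 (by linarith [hu.1, pi_pos]) (by linarith [hu.2])
  have hbound := weighted_sum_le_two_mul hsin hle (sin_sq_add_cos_sq u) (norm_nonneg ψ)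
    (norm_chsh_apply_sq_le hA0 hA1 hB0S hB1S hA0sq hA1sq hB0Ssq hB1Ssq
      hc00S hc01S hc10S hc11S ψ)
    (norm_crossed_apply_sq_le hA0 hA1 hB0L hB1L hA0sq hA1sq hB0Lsq hB1Lsq
      hc00L hc01L hc10L hc11L hBL ψ)
    (norm_commutator_sq_add_norm_anticommutator_sq hA0 hA1 hA0sq hA1sq ψ)
  have hCψ : (⟪ψ, C ψ⟫_ℂ).re ≤ ‖ψ‖ * ‖C ψ‖ := re_inner_le_norm (𝕜 := ℂ) ψ (C ψ)
  have hJψ : (⟪ψ, J ψ⟫_ℂ).re ≤ ‖ψ‖ * ‖J ψ‖ := re_inner_le_norm (𝕜 := ℂ) ψ (J ψ)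
  have h2 : (⟪ψ, (2 : H →L[ℂ] H) ψ⟫_ℂ).re = 2 * ‖ψ‖ ^ 2 := re_inner_ofNat_apply 2 ψ
  simp only [sub_apply, smul_apply, inner_sub_right,
    inner_smul_right, Complex.sub_re, Complex.re_ofReal_mul, h2]
  nlinarith [mul_le_mul_of_nonneg_left hCψ hsin,
    mul_le_mul_of_nonneg_left hJψ (sub_nonneg.2 hle),
    mul_le_mul_of_nonneg_left hbound (norm_nonneg ψ)]
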